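/- arXiv:1608.07299 — 2 statements merged into one kernel-verified Lean document; each statement's English description precedes it below -/
import Mathlib

section
/- Let e be a no-signalling possibilistic (2,2,2) empirical model such that: (i) e is outcome-symmetric, i.e. e x y a b ↔ e x y (1−a) (1−b) for all x y a b; (ii) e is logically nonlocal; and (iii) e is not strongly nonlocal, i.e. there exists a deterministic grid consistent with e. Then, up to relabelling, e is the model whose support is the diagonal in three contexts and full in the fourth: there exist permutations σ τ of Fin 2 and families of permutations α β : Fin 2 → Equiv.Perm (Fin 2) such that for all x y a b, e (σ x) (τ y) (α x a) (β y b) ↔ ((x = 1 ∧ y = 0) ∨ a = b). -/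
/-- A possibilistic (2,2,2) empirical model is no-signalling. -/
def NoSignalling (e : Fin 2 → Fin 2 → Fin 2 → Fin 2 → Prop) : Prop :=
  (∀ x y y' a, (∃ b, e x y a b) → ∃ b, e x y' a b) ∧
  (∀ y x x' b, (∃ a, e x y a b) → ∃ a, e x' y a b)

/-- A possibilistic (2,2,2) empirical model is local. -/
def IsLocal (e : Fin 2 → Fin 2 → Fin 2 → Fin 2 → Prop) : Prop :=
  ∀ x y a b, e x y a b → ∃ f g : Fin 2 → Fin 2, f x = a ∧ g y = b ∧
    ∀ x' y', e x' y' (f x') (g y')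

/-- every outcome-symmetric, no-signalling possibilistic (2,2,2) empirical
model which is logically but not strongly nonlocal is, up to relabelling, the model whose
support is the diagonal in three contexts and full in the fourth. -/
theorem stmt_8 (e : Fin 2 → Fin 2 → Fin 2 → Fin 2 → Prop)
    (hns : NoSignalling e)
    (hsym : ∀ x y a b, e x y a b ↔ e x y (1 - a) (1 - b))
    (hlnl : ¬ IsLocal e)
    (hnotstrong : ∃ f g : Fin 2 → Fin 2, ∀ x y, e x y (f x) (g y)) :
    ∃ (σ τ : Equiv.Perm (Fin 2)) (α β : Fin 2 → Equiv.Perm (Fin 2)),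
      ∀ x y a b, e (σ x) (τ y) (α x a) (β y b) ↔ ((x = 1 ∧ y = 0) ∨ a = b) := by
  obtain ⟨f, g, hfg⟩ := hnotstrong
  have key : ∀ x y a b, e x y a b ↔ (a + f x = b + g y ∨ e x y (f x) (g y + 1)) := by
    intro x y a b
    have h1 := hfg x y
    have h2 := hsym x y (f x) (g y)
    have h3 := hsym x y (f x) (g y + 1)
    generalize f x = p at *
    generalize g y = q at *
    generalize e x y = r at *
    clear hfg hsym hlnl hns
    fin_cases p <;> fin_cases q <;> fin_cases a <;> fin_cases b <;> simp_all
  generalize ho : (fun x y => e x y (f x) (g y + 1)) = o at *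
  have key' : ∀ x y a b, e x y a b ↔ (a + f x = b + g y ∨ o x y) := by
    subst ho; exact key
  clear key ho
  unfold IsLocal at hlnl
  push Not at hlnl
  obtain ⟨x0, y0, a, b, hab, hno⟩ := hlnl
  -- a grid obtained by adding offsets to the given one
  have grid : ∀ u v : Fin 2 → Fin 2, u x0 = a + f x0 → v y0 = b + g y0 →
      ∃ x y, u x ≠ v y ∧ ¬ o x y := by
    intro u v hu hv
    have two : ∀ p q : Fin 2, p + q + q = p := by decide
    obtain ⟨x, y, h⟩ := hno (fun x => u x + f x) (fun y => v y + g y)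
      (by simp only [hu, two]) (by simp only [hv, two])
    rw [key'] at h
    simp only [two] at h
    push Not at h
    exact ⟨x, y, h.1, h.2⟩
  rw [key'] at hab
  have hne : a + f x0 ≠ b + g y0 := by
    intro h
    obtain ⟨x, y, h1, _⟩ := grid (fun _ => a + f x0) (fun _ => b + g y0) rfl rfl
    exact h1 h
  have ho0 : o x0 y0 := hab.resolve_left hne
  have cases2 : ∀ z w : Fin 2, z = w ∨ z = w + 1 := by decide
  have ne1 : ∀ z : Fin 2, z + 1 ≠ z := by decide
  have hrow : ¬ o x0 (y0 + 1) := by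
    intro h
    obtain ⟨x, y, h1, h2⟩ := grid (fun x => if x = x0 then a + f x0 else b + g y0)
      (fun _ => b + g y0) (by simp) (by simp)
    rcases cases2 x x0 with hx | hx <;> rcases cases2 y y0 with hy | hy <;>
      rw [hx, hy] at h2 <;> first | exact h2 ho0 | exact h2 h | simp [hx, hy] at h1
  have hcol : ¬ o (x0 + 1) y0 := by
    intro h
    obtain ⟨x, y, h1, h2⟩ := grid (fun _ => a + f x0)
      (fun y => if y = y0 then b + g y0 else a + f x0) (by simp) (by simp)
    rcases cases2 x x0 with hx | hx <;> rcases cases2 y y0 with hy | hy <;>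
      rw [hx, hy] at h2 <;> first | exact h2 ho0 | exact h2 h | simp [hx, hy] at h1
  have hdia : ¬ o (x0 + 1) (y0 + 1) := by
    intro h
    obtain ⟨x, y, h1, h2⟩ := grid (fun x => if x = x0 then a + f x0 else b + g y0)
      (fun y => if y = y0 then b + g y0 else a + f x0) (by simp) (by simp)
    rcases cases2 x x0 with hx | hx <;> rcases cases2 y y0 with hy | hy <;>
      rw [hx, hy] at h2 <;> first | exact h2 ho0 | exact h2 h | simp [hx, hy] at h1
  have two : ∀ p q : Fin 2, p + q + q = p := by decide
  refine ⟨Equiv.addRight (x0 + 1), Equiv.addRight y0,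
    fun x => Equiv.addRight (f (x + (x0 + 1))), fun y => Equiv.addRight (g (y + y0)), ?_⟩
  intro x y c d
  rw [key']
  simp only [Equiv.coe_addRight, two]
  have e1 : 1 + (x0 + 1) = x0 := (by decide : ∀ z : Fin 2, 1 + (z + 1) = z) x0
  have e2 : 0 + (x0 + 1) = x0 + 1 := zero_add _
  have e3 : 1 + y0 = y0 + 1 := add_comm _ _
  have hx : x = 0 ∨ x = 1 := by revert x; decide
  have hy : y = 0 ∨ y = 1 := by revert y; decide
  rcases hx with rfl | rfl <;> rcases hy with rfl | rfl <;>
    simp only [e1, e2, e3, zero_add] <;> simp [ho0, hrow, hcol, hdia]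
end

section
/- Every Chen et al. paradox contains a Hardy paradox: let e be a possibilistic (2,2,l) empirical model (Alice's measurements labelled 0 = A₁, 1 = A₂; Bob's labelled 0 = B₁, 1 = B₂) satisfying: ¬ e 1 0 a b whenever b.val < a.val (the event A₂ > B₁ is impossible); ¬ e 0 0 a b whenever a.val < b.val (the event B₁ > A₁ is impossible); and ¬ e 0 1 a b whenever b.val < a.val (the event A₁ > B₂ is impossible). Then every possible outcome (i, j) of the context (1,1) with j.val < i.val (a Chen et al. paradoxical event A₂ > B₂) witnesses a coarse-grained Hardy paradox; in particular, if e 1 1 i j holds for some i j with j.val < i.val, then e contains a coarse-grained Hardy paradox. -/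
/-- The outcome `(a₀,b₀)` of context `(x₀,y₀)` witnesses a coarse-grained Hardy paradox
in the possibilistic (2,2,l) empirical model `e`. -/
def WitnessesCGHardy {l : ℕ} (e : Fin 2 → Fin 2 → Fin l → Fin l → Prop)
    (x₀ y₀ : Fin 2) (a₀ b₀ : Fin l) : Prop :=
  ∃ (x₁ y₁ : Fin 2) (S T : Set (Fin l)), x₀ ≠ x₁ ∧ y₀ ≠ y₁ ∧
    e x₀ y₀ a₀ b₀ ∧ (∀ b ∉ T, ¬ e x₀ y₁ a₀ b) ∧ (∀ a ∉ S, ¬ e x₁ y₀ a b₀) ∧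
    (∀ a ∈ S, ∀ b ∈ T, ¬ e x₁ y₁ a b)

/-- The possibilistic (2,2,l) empirical model `e` contains a coarse-grained Hardy
paradox. -/
def ContainsCGHardy {l : ℕ} (e : Fin 2 → Fin 2 → Fin l → Fin l → Prop) : Prop :=
  ∃ x₀ y₀ a₀ b₀, WitnessesCGHardy e x₀ y₀ a₀ b₀

/-- every Chen et al. paradox contains a Hardy paradox: under the Chen et
al. impossibility conditions, every possible outcome `(i,j)` with `j < i` of the context
`(A₂,B₂)` witnesses a coarse-grained Hardy paradox; in particular if such an outcome is
possible the model contains a coarse-grained Hardy paradox. -/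
theorem stmt_10 {l : ℕ} (e : Fin 2 → Fin 2 → Fin l → Fin l → Prop)
    (h1 : ∀ a b : Fin l, b.val < a.val → ¬ e 1 0 a b)
    (h2 : ∀ a b : Fin l, a.val < b.val → ¬ e 0 0 a b)
    (h3 : ∀ a b : Fin l, b.val < a.val → ¬ e 0 1 a b) :
    (∀ i j : Fin l, j.val < i.val → e 1 1 i j → WitnessesCGHardy e 1 1 i j) ∧
    ((∃ i j : Fin l, j.val < i.val ∧ e 1 1 i j) → ContainsCGHardy e) := by
  have key : ∀ i j : Fin l, j.val < i.val → e 1 1 i j → WitnessesCGHardy e 1 1 i j := by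
    intro i j hij he
    refine ⟨0, 0, {a | a.val ≤ j.val}, {b | i.val ≤ b.val}, by decide, by decide, he, ?_, ?_, ?_⟩
    · intro b hb
      exact h1 i b (not_le.mp hb)
    · intro a ha
      exact h3 a j (not_le.mp ha)
    · intro a ha b hb
      exact h2 a b (lt_of_le_of_lt ha (lt_of_lt_of_le hij hb))
  refine ⟨key, ?_⟩
  rintro ⟨i, j, hij, he⟩
  exact ⟨1, 1, i, j, key i j hij he⟩
end
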